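/- Let (X,A₁,...,Aₙ) satisfy condition (*) with a ∈ ⋃ᵢ₌₁ⁿ Aᵢ. If π₁(X,a) is finite and π₁^top(X/(A₁,...,Aₙ),*) is Hausdorff, then π₁(X/(A₁,...,Aₙ),*) is finite and X/(A₁,...,Aₙ) is semi-locally simply connected. -/

import Mathlib

/-- The relation on `X` collapsing each member of the family `A` of subsets to a point: the
quotient `Quot (collapseRelFam A)` is the quotient space `X/(A₁,…,Aₙ)`. -/
def collapseRelFam {X : Type*} {n : ℕ} (A : Fin n → Set X) : X → X → Prop :=
  fun x y => ∃ i, x ∈ A i ∧ y ∈ A i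

/-- Condition (*) on the `(n+1)`-tuple `(X, A₁, …, Aₙ)`: either
(i) `X` is path connected and each `Aᵢ` is open with path connected closure, or
(ii) `X` is first countable, connected and locally path connected, and each `Aᵢ` is open or
closed, with pairwise disjoint path connected closures. -/
def StarCondition {X : Type*} [TopologicalSpace X] {n : ℕ} (A : Fin n → Set X) : Prop :=
  (PathConnectedSpace X ∧ ∀ i, IsOpen (A i) ∧ IsPathConnected (closure (A i))) ∨
  (FirstCountableTopology X ∧ ConnectedSpace X ∧ LocPathConnectedSpace X ∧
    (∀ i, IsOpen (A i) ∨ IsClosed (A i)) ∧ (∀ i, IsPathConnected (closure (A i))) ∧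
    ∀ i j, i ≠ j → Disjoint (closure (A i)) (closure (A j)))

/-- The topological fundamental group `π₁ᵗᵒᵖ(X,x)`: homotopy classes of loops at `x` with the
quotient topology induced from the loop space (with the compact-open topology). -/
instance pathHomotopicQuotientTopology {X : Type*} [TopologicalSpace X] (x y : X) :
    TopologicalSpace (Path.Homotopic.Quotient x y) :=
  inferInstanceAs (TopologicalSpace (Quotient (Path.Homotopic.setoid x y)))


/-- A space `Y` is semi-locally simply connected if every point `y` has an open neighborhood `U`
such that the inclusion `U → Y` induces the trivial homomorphism `π₁(U,y) → π₁(Y,y)`, i.e. every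
loop in `U` at `y` is nullhomotopic in `Y`. -/
def SemiLocallySimplyConnected (Y : Type*) [TopologicalSpace Y] : Prop :=
  ∀ y : Y, ∃ U : Set Y, IsOpen U ∧ ∃ hy : y ∈ U,
    ∀ γ : Path (⟨y, hy⟩ : U) (⟨y, hy⟩ : U),
      (γ.map continuous_subtype_val).Homotopic (Path.refl y)


open Set Filter Topology unitInterval

namespace Path

variable {X Y : Type*} [TopologicalSpace X] [TopologicalSpace Y]

/-- A path in `Y` lifts up to homotopy along `p : X → Y` if, for every choice of lifts of its
endpoints, it is homotopic to the image of a path of `X` joining them. -/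
def LiftsUpToHomotopy (p : C(X, Y)) {y y' : Y} (ε : Path y y') : Prop :=
  ∀ x x' (hx : y = p x) (hx' : y' = p x'),
    ∃ τ : Path x x', ((τ.map p.continuous).cast hx hx').Homotopic ε

namespace LiftsUpToHomotopy

variable {p : C(X, Y)} {y y' y'' : Y}

lemma of_homotopic {ε ε' : Path y y'} (h : LiftsUpToHomotopy p ε) (hε : ε.Homotopic ε') :
    LiftsUpToHomotopy p ε' := fun x x' hx hx' =>
  let ⟨τ, hτ⟩ := h x x' hx hx'
  ⟨τ, hτ.trans hε⟩

lemma congr {z z' : Y} {ε : Path y y'} {ε' : Path z z'} (h : LiftsUpToHomotopy p ε)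
    (hε : ∀ t, ε t = ε' t) : LiftsUpToHomotopy p ε' := by
  obtain rfl : y = z := by simpa using hε 0
  obtain rfl : y' = z' := by simpa using hε 1
  obtain rfl : ε = ε' := Path.ext (funext hε)
  exact h

lemma symm {ε : Path y y'} (h : LiftsUpToHomotopy p ε) : LiftsUpToHomotopy p ε.symm := by
  rintro x x' rfl rfl
  obtain ⟨τ, hτ⟩ := h x' x rfl rfl
  exact ⟨τ.symm, hτ.symm₂⟩

lemma trans (hp : Function.Surjective p) {ε : Path y y'} {ε' : Path y' y''}
    (h : LiftsUpToHomotopy p ε) (h' : LiftsUpToHomotopy p ε') :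
    LiftsUpToHomotopy p (ε.trans ε') := by
  rintro x x'' rfl rfl
  obtain ⟨x', rfl⟩ := hp y'
  obtain ⟨τ, hτ⟩ := h x x' rfl rfl
  obtain ⟨τ', hτ'⟩ := h' x' x'' rfl rfl
  refine ⟨τ.trans τ', ?_⟩
  have := hτ.hcomp hτ'
  simpa [Path.map_trans] using this

lemma map (hF : ∀ y, LiftsUpToHomotopy p (Path.refl y)) {x x' : X} (τ : Path x x') :
    LiftsUpToHomotopy p (τ.map p.continuous) := by
  intro z z' hz hz'
  obtain ⟨ρ, hρ⟩ := hF _ z x hz rfl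
  obtain ⟨ρ', hρ'⟩ := hF _ x' z' rfl hz'
  refine ⟨(ρ.trans τ).trans ρ', ?_⟩
  have h₁ := (hρ.hcomp (Path.Homotopic.refl (τ.map p.continuous))).hcomp hρ'
  have h₂ : (((Path.refl (p x)).trans (τ.map p.continuous)).trans (Path.refl (p x'))).Homotopic
      (τ.map p.continuous) :=
    ⟨(Path.Homotopy.transRefl _).trans (Path.Homotopy.reflTrans _)⟩
  refine Path.Homotopic.trans ?_ (h₁.trans h₂)
  have : (((ρ.trans τ).trans ρ').map p.continuous).cast hz hz' =
      (((ρ.map p.continuous).cast hz rfl).trans (τ.map p.continuous)).trans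
        ((ρ'.map p.continuous).cast rfl hz') := by
    ext t
    simp [Path.map_trans, Path.trans_apply]
  rw [this]

end LiftsUpToHomotopy

/-- Two points are joined inside `O` by a path lifting up to homotopy along `p`. -/
def JoinedLiftIn (p : C(X, Y)) (O : Set Y) (y y' : Y) : Prop :=
  ∃ ε : Path y y', (∀ t, ε t ∈ O) ∧ LiftsUpToHomotopy p ε

namespace JoinedLiftIn

variable {p : C(X, Y)} {O : Set Y} {y y' y'' : Y}

lemma symm (h : JoinedLiftIn p O y y') : JoinedLiftIn p O y' y :=
  let ⟨ε, hO, hε⟩ := h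
  ⟨ε.symm, fun _ => hO _, hε.symm⟩

lemma trans (hp : Function.Surjective p) (h : JoinedLiftIn p O y y')
    (h' : JoinedLiftIn p O y' y'') : JoinedLiftIn p O y y'' := by
  obtain ⟨ε, hO, hε⟩ := h
  obtain ⟨ε', hO', hε'⟩ := h'
  refine ⟨ε.trans ε', fun t => ?_, hε.trans hp hε'⟩
  rw [Path.trans_apply]
  split_ifs
  exacts [hO _, hO' _]

end JoinedLiftIn

/-- A neighborhood of a path contains every path whose graph is contained in some open
neighborhood of the graph of the given path. -/
lemma exists_isOpen_graph_subset {y y' : Y} (γ : Path y y') {W : Set (Path y y')}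
    (hW : W ∈ 𝓝 γ) : ∃ G : Set (I × Y), IsOpen G ∧ (∀ t, (t, γ t) ∈ G) ∧
      ∀ γ' : Path y y', (∀ t, (t, γ' t) ∈ G) → γ' ∈ W := by
  let l : Filter C(I, Y) := (𝓝ˢ (range fun t => (t, γ t))).lift' fun G => {f | ∀ t, (t, f t) ∈ G}
  have hmono : Monotone fun G : Set (I × Y) => {f : C(I, Y) | ∀ t, (t, f t) ∈ G} :=
    fun G G' h f hf t => h (hf t)
  have hl : l ≤ 𝓝 (γ : C(I, Y)) := by
    rw [← tendsto_id', ContinuousMap.tendsto_nhds_compactOpen]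
    intro K hK U hU hKU
    have hG : IsOpen (((Kᶜ : Set I) ×ˢ (univ : Set Y)) ∪ (univ : Set I) ×ˢ U) :=
      (hK.isClosed.isOpen_compl.prod isOpen_univ).union (isOpen_univ.prod hU)
    have hmem : ((Kᶜ : Set I) ×ˢ (univ : Set Y)) ∪ (univ : Set I) ×ˢ U ∈
        𝓝ˢ (range fun t => (t, γ t)) := by
      rw [hG.mem_nhdsSet]
      rintro _ ⟨t, rfl⟩
      by_cases ht : t ∈ K
      · exact Or.inr ⟨mem_univ _, hKU ht⟩
      · exact Or.inl ⟨ht, mem_univ _⟩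
    filter_upwards [mem_lift' hmem] with f hf t ht
    rcases hf t with h | h
    · exact absurd ht h.1
    · exact h.2
  rw [nhds_induced] at hW
  obtain ⟨V, hV, hVW⟩ := hW
  obtain ⟨G', hG', hsub⟩ := (mem_lift'_sets hmono).1 (hl hV)
  obtain ⟨G, hGo, hG, hGG'⟩ := mem_nhdsSet_iff_exists.1 hG'
  exact ⟨G, hGo, fun t => hG ⟨t, rfl⟩, fun γ' h => hVW (hsub fun t => hGG' (h t))⟩

/-- The path underlying a continuous map on the unit interval. -/
def ofMap (f : C(I, Y)) : Path (f 0) (f 1) := ⟨f, rfl, rfl⟩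

@[simp] lemma ofMap_apply (f : C(I, Y)) (t : I) : ofMap f t = f t := rfl

/-- On `[u, v]`, the continuous map `γ` can be replaced by one with the same endpoints, with graph
in `G`, and which lifts up to homotopy along `p`. -/
def HasLiftingReplacement (p : C(X, Y)) (G : Set (I × Y)) (γ : C(I, Y)) (u v : I) : Prop :=
  ∃ f : C(I, Y), f u = γ u ∧ f v = γ v ∧ (∀ t ∈ Icc u v, (t, f t) ∈ G) ∧
    LiftsUpToHomotopy p ((ofMap f).subpath u v)

namespace HasLiftingReplacement

variable {p : C(X, Y)} {G : Set (I × Y)} {γ : C(I, Y)} {u v w : I}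

lemma trans (hp : Function.Surjective p) (huv : u ≤ v) (hvw : v ≤ w)
    (h : HasLiftingReplacement p G γ u v) (h' : HasLiftingReplacement p G γ v w) :
    HasLiftingReplacement p G γ u w := by
  obtain ⟨f, hfu, hfv, hfG, hf⟩ := h
  obtain ⟨g, hgv, hgw, hgG, hg⟩ := h'
  let k : C(I, Y) := ⟨fun t => if t ≤ v then f t else g t,
    Continuous.if_le f.continuous g.continuous continuous_id continuous_const
      (by rintro _ rfl; rw [hfv, hgv])⟩
  have hkf : ∀ t ≤ v, k t = f t := fun t ht => if_pos ht
  have hkg : ∀ t, v ≤ t → k t = g t := by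
    intro t ht
    rcases ht.eq_or_lt with rfl | ht
    · rw [hkf _ le_rfl, hfv, hgv]
    · exact if_neg ht.not_ge
  refine ⟨k, by rw [hkf u huv, hfu], by rw [hkg w hvw, hgw], fun t ht => ?_, ?_⟩
  · rcases le_total t v with h | h
    · rw [hkf t h]; exact hfG t ⟨ht.1, h⟩
    · rw [hkg t h]; exact hgG t ⟨h, ht.2⟩
  · have hmem : ∀ {a b : I}, a ≤ b → ∀ s, Icc.convexComb a b s ∈ Icc a b := by
      intro a b hab s
      have := mem_range_self (f := Icc.convexComb a b) s
      rwa [range_subpathAux, uIcc_of_le hab] at this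
    have h₁ : LiftsUpToHomotopy p ((ofMap k).subpath u v) :=
      hf.congr fun s => (hkf _ (hmem huv s).2).symm
    have h₂ : LiftsUpToHomotopy p ((ofMap k).subpath v w) :=
      hg.congr fun s => (hkg _ (hmem hvw s).1).symm
    exact (h₁.trans hp h₂).of_homotopic ⟨Homotopy.subpathTransSubpath _ u v w⟩

lemma of_joinedLiftIn (hF : ∀ y, LiftsUpToHomotopy p (Path.refl y)) {N : Set I} {O : Set Y}
    (huv : u ≤ v) (hN : Icc u v ⊆ N) (hNO : N ×ˢ O ⊆ G) (hγ : γ u ∈ O)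
    (h : JoinedLiftIn p O (γ u) (γ v)) : HasLiftingReplacement p G γ u v := by
  rcases huv.eq_or_lt with rfl | huv
  · refine ⟨γ, rfl, rfl, fun t ht => ?_, (hF (γ u)).congr fun t => ?_⟩
    · obtain rfl : u = t := le_antisymm ht.1 ht.2
      exact hNO ⟨hN ht, hγ⟩
    · rw [subpath_self]; rfl
  obtain ⟨ε, hεO, hε⟩ := h
  have huv' : (0 : ℝ) < v - u := sub_pos.2 huv
  let f : C(I, Y) := ⟨fun t => ε (projIcc 0 1 zero_le_one ((t - u) / (v - u) : ℝ)), by fun_prop⟩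
  have hf : ∀ s, f (Icc.convexComb u v s) = ε s := by
    intro s
    have : (((Icc.convexComb u v s : I) : ℝ) - u) / (v - u) = s := by
      rw [div_eq_iff huv'.ne']
      simp [Icc.convexComb]
      ring
    change ε (projIcc 0 1 zero_le_one _) = ε s
    rw [this, projIcc_val]
  refine ⟨f, by simpa using hf 0, by simpa using hf 1, fun t ht => hNO ⟨hN ht, hεO _⟩,
    hε.congr fun s => (hf s).symm⟩

end HasLiftingReplacement

/-- If the constant paths and, locally, all paths can be replaced by paths lifting up to homotopy
along `p`, then such paths are dense in the space of paths. -/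
theorem exists_mem_liftsUpToHomotopy {p : C(X, Y)} (hp : Function.Surjective p)
    (hF : ∀ y, LiftsUpToHomotopy p (Path.refl y))
    (hL : ∀ (γ : C(I, Y)) (O : Set Y), IsOpen O → ∀ u v : I, u ≤ v → MapsTo γ (Icc u v) O →
      JoinedLiftIn p O (γ u) (γ v))
    {y y' : Y} (γ : Path y y') {W : Set (Path y y')} (hW : W ∈ 𝓝 γ) :
    ∃ γ' ∈ W, LiftsUpToHomotopy p γ' := by
  obtain ⟨G, hG, hγG, hGW⟩ := γ.exists_isOpen_graph_subset hW
  have hloc : ∀ t : I, ∃ c : Set I, IsOpen c ∧ t ∈ c ∧ ∀ u v : I, u ≤ v → Icc u v ⊆ c →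
      HasLiftingReplacement p G (γ : C(I, Y)) u v := by
    intro t
    obtain ⟨N, O, hN, hO, htN, htO, hNO⟩ := isOpen_prod_iff.1 hG t (γ t) (hγG t)
    refine ⟨N ∩ γ ⁻¹' O, hN.inter (hO.preimage γ.continuous), ⟨htN, htO⟩, fun u v huv hc => ?_⟩
    exact .of_joinedLiftIn hF huv (fun s hs => (hc hs).1) hNO (hc ⟨le_rfl, huv⟩).2
      (hL _ O hO u v huv fun s hs => (hc hs).2)
  choose c hc htc hcR using hloc
  obtain ⟨t, ht0, htm, ⟨n, hn⟩, htc'⟩ := exists_monotone_Icc_subset_open_cover_unitInterval hc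
    fun t _ => mem_iUnion.2 ⟨t, htc t⟩
  have hR : ∀ k, HasLiftingReplacement p G (γ : C(I, Y)) 0 (t k) := by
    intro k
    induction k with
    | zero =>
      rw [ht0]
      exact hcR 0 0 0 le_rfl (by simpa using htc 0)
    | succ k ih =>
      obtain ⟨i, hi⟩ := htc' k
      exact ih.trans hp (nonneg _) (htm k.le_succ) (hcR i _ _ (htm k.le_succ) hi)
  obtain ⟨f, hf0, hf1, hfG, hf⟩ := hR n
  rw [hn n le_rfl] at hf hf1 hfG
  refine ⟨⟨f, by simpa using hf0, by simpa using hf1⟩,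
    hGW _ fun t => hfG t ⟨nonneg _, le_one _⟩, hf.congr fun s => ?_⟩
  rw [subpath_zero_one]
  rfl

end Path

section ClosureSingleton

variable {Y : Type*} [TopologicalSpace Y] {q : Y}

/-- A map into `closure {q}` is continuous if it is continuous on a closed set
off which it is constant equal to `q`. -/
lemma continuous_of_eq_off_isClosed {Z : Type*} [TopologicalSpace Z] {f : Z → Y} {C : Set Z}
    (hC : IsClosed C) (hf : ContinuousOn f C) (hq : ∀ z ∈ C, f z ∈ closure {q})
    (hfq : ∀ z ∉ C, f z = q) : Continuous f := by
  refine continuous_def.2 fun V hV => ?_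
  by_cases hqV : q ∈ V
  · have : f ⁻¹' V = (C ∩ f ⁻¹' Vᶜ)ᶜ := by
      ext z
      by_cases hz : z ∈ C <;> simp [hz, hfq, hqV]
    rw [this]
    exact (hf.preimage_isClosed_of_isClosed hC hV.isClosed_compl).isOpen_compl
  · have : f ⁻¹' V = ∅ := by
      refine eq_empty_of_forall_notMem fun z hz => hqV ?_
      by_cases hzC : z ∈ C
      · obtain ⟨_, h, rfl⟩ := mem_closure_iff.1 (hq z hzC) V hV hz
        exact h
      · rwa [← hfq z hzC]
    rw [this]
    exact isOpen_empty

lemma Path.homotopic_of_mem_closure_singleton {y y' : Y}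
    {δ ε : Path y y'} (hδ : ∀ t, δ t ∈ closure {q}) (hε : ∀ t, ε t ∈ closure {q}) :
    δ.Homotopic ε := by
  classical
  let f : I × I → Y := fun z =>
    if z.1 = 0 then δ z.2 else if z.1 = 1 then ε z.2 else
      if z.2 = 0 then y else if z.2 = 1 then y' else q
  let C₁ : Set (I × I) := {z | z.1 = 0}
  let C₂ : Set (I × I) := {z | z.1 = 1}
  let C₃ : Set (I × I) := {z | z.2 = 0}
  let C₄ : Set (I × I) := {z | z.2 = 1}
  have c₁ : IsClosed C₁ := isClosed_eq continuous_fst continuous_const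
  have c₂ : IsClosed C₂ := isClosed_eq continuous_fst continuous_const
  have c₃ : IsClosed C₃ := isClosed_eq continuous_snd continuous_const
  have c₄ : IsClosed C₄ := isClosed_eq continuous_snd continuous_const
  have f₁ : ContinuousOn f C₁ := (δ.continuous.comp continuous_snd).continuousOn.congr
    fun z (hz : z.1 = 0) => by simp [f, hz]
  have f₂ : ContinuousOn f C₂ := (ε.continuous.comp continuous_snd).continuousOn.congr
    fun z (hz : z.1 = 1) => by simp [f, hz]
  have f₃ : ContinuousOn f C₃ := (continuous_const (y := y)).continuousOn.congr
    fun z (hz : z.2 = 0) => by simp [f, hz]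
  have f₄ : ContinuousOn f C₄ := (continuous_const (y := y')).continuousOn.congr
    fun z (hz : z.2 = 1) => by simp [f, hz]
  have hf : Continuous f := by
    refine continuous_of_eq_off_isClosed (((c₁.union c₂).union c₃).union c₄)
      (((f₁.union_of_isClosed f₂ c₁ c₂).union_of_isClosed f₃ (c₁.union c₂) c₃).union_of_isClosed
        f₄ ((c₁.union c₂).union c₃) c₄) (fun z _ => ?_) (q := q) fun z hz => ?_
    · simp only [f]
      split_ifs
      exacts [hδ _, hε _, by simpa using hδ 0, by simpa using hδ 1, subset_closure rfl]
    · simp only [C₁, C₂, C₃, C₄, mem_union, mem_ofPred_eq, not_or] at hz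
      simp [f, hz]
  exact ⟨{ toFun := f
           continuous_toFun := hf
           map_zero_left := fun t => by simp [f]
           map_one_left := fun t => by simp [f]
           prop' := by
            rintro s t (rfl | rfl) <;> simp [f] }⟩

lemma Path.exists_eq_of_mem_closure_singleton {y y' : Y}
    (hy : y ∈ closure {q}) (hy' : y' ∈ closure {q}) :
    ∃ ε : Path y y', ∀ t, ε t ∈ ({y, y', q} : Set Y) ∧ ε t ∈ closure {q} := by
  classical
  let f : I → Y := fun t => if t = 0 then y else if t = 1 then y' else q
  have hmem : ∀ t, f t ∈ closure {q} := by
    intro t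
    simp only [f]
    split_ifs
    exacts [hy, hy', subset_closure rfl]
  have hf : Continuous f := by
    refine continuous_of_eq_off_isClosed (C := {0, 1}) (q := q) (toFinite _).isClosed ?_
      (fun z _ => hmem z) fun z hz => ?_
    · exact (toFinite _).continuousOn _
    · simp only [mem_insert_iff, mem_singleton_iff, not_or] at hz
      simp [f, hz]
  refine ⟨⟨⟨f, hf⟩, by simp [f], by simp [f]⟩, fun t => ⟨?_, hmem t⟩⟩
  change f t ∈ _
  simp only [f]
  split_ifs <;> simp

end ClosureSingleton

section Collapse

variable {X : Type*} [TopologicalSpace X] {n : ℕ} {A : Fin n → Set X}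

/-- The quotient map collapsing each member of the family `A` to a point. -/
def collapseMap (A : Fin n → Set X) : C(X, Quot (collapseRelFam A)) :=
  ⟨Quot.mk _, continuous_quot_mk⟩

lemma collapseMap_surjective : Function.Surjective (collapseMap A) := Quot.mk_surjective

lemma isOpen_preimage_collapseMap {V : Set (Quot (collapseRelFam A))} :
    IsOpen (collapseMap A ⁻¹' V) ↔ IsOpen V :=
  isQuotientMap_quot_mk.isOpen_preimage

lemma collapseMap_eq_of_mem {i : Fin n} {x x' : X} (hx : x ∈ A i) (hx' : x' ∈ A i) :
    collapseMap A x = collapseMap A x' :=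
  Quot.sound ⟨i, hx, hx'⟩

lemma eq_or_mem_of_collapseMap_eq {x x' : X} (h : collapseMap A x = collapseMap A x') :
    x = x' ∨ (∃ i, x ∈ A i) ∧ ∃ i, x' ∈ A i := by
  replace h := Quot.eqvGen_exact h
  induction h with
  | rel x y h => exact Or.inr ⟨h.imp fun i h => h.1, h.imp fun i h => h.2⟩
  | refl => exact Or.inl rfl
  | symm x y h ih => exact ih.imp Eq.symm And.symm
  | trans x y z h h' ih ih' =>
    rcases ih with rfl | ih
    · exact ih'
    · rcases ih' with rfl | ih'
      exacts [Or.inr ih, Or.inr ⟨ih.1, ih'.2⟩]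

lemma isOpenMap_collapseMap (hA : ∀ i, IsOpen (A i)) : IsOpenMap (collapseMap A) := by
  intro V hV
  rw [← isOpen_preimage_collapseMap, isOpen_iff_mem_nhds]
  rintro x ⟨v, hv, hvx⟩
  rcases eq_or_mem_of_collapseMap_eq hvx with rfl | ⟨-, i, hi⟩
  · exact mem_of_superset (hV.mem_nhds hv) (subset_preimage_image _ _)
  · refine mem_of_superset ((hA i).mem_nhds hi) fun z hz => ⟨v, hv, ?_⟩
    rw [hvx, collapseMap_eq_of_mem hi hz]

lemma isOpen_singleton_collapseMap (hA : ∀ i, IsOpen (A i)) {i : Fin n} {x : X} (hx : x ∈ A i) :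
    IsOpen {collapseMap A x} := by
  have : {collapseMap A x} = collapseMap A '' A i := by
    refine Subset.antisymm (singleton_subset_iff.2 ⟨x, hx, rfl⟩) ?_
    rintro _ ⟨z, hz, rfl⟩
    exact collapseMap_eq_of_mem hz hx
  rw [this]
  exact isOpenMap_collapseMap hA _ (hA i)

lemma collapseMap_mem_closure {i : Fin n} {x z : X} (hx : x ∈ A i) (hz : z ∈ closure (A i)) :
    collapseMap A z ∈ closure {collapseMap A x} :=
  map_mem_closure (collapseMap A).continuous hz fun _ h => collapseMap_eq_of_mem h hx

/-- Collapsing sets with path connected closures, any two points in the same fiber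
are joined by a path with nullhomotopic image. -/
lemma liftsUpToHomotopy_refl_collapseMap (hpc : ∀ i, IsPathConnected (closure (A i)))
    (y : Quot (collapseRelFam A)) :
    Path.LiftsUpToHomotopy (collapseMap A) (Path.refl y) := by
  intro x x' hx hx'
  have := Quot.eqvGen_exact (hx.symm.trans hx')
  induction this with
  | rel x x' h =>
    obtain ⟨i, hxi, hxi'⟩ := h
    subst hx
    obtain ⟨τ, hτ⟩ := (hpc i).joinedIn x (subset_closure hxi) x' (subset_closure hxi')
    exact ⟨τ, Path.homotopic_of_mem_closure_singleton (q := collapseMap A x)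
      (fun t => collapseMap_mem_closure hxi (hτ t)) fun t => subset_closure rfl⟩
  | refl x => subst hx; exact ⟨Path.refl x, by rfl⟩
  | symm x x' h ih =>
    obtain ⟨τ, hτ⟩ := ih hx' hx
    exact ⟨τ.symm, hτ.symm₂⟩
  | trans x x₁ x' h h' ih ih' =>
    have hx₁ : y = collapseMap A x₁ := hx.trans (Quot.eqvGen_sound h)
    obtain ⟨τ, hτ⟩ := ih hx hx₁
    obtain ⟨τ', hτ'⟩ := ih' hx₁ hx'
    refine ⟨τ.trans τ', ?_⟩
    have h := (hτ.hcomp hτ').trans ⟨Path.Homotopy.transRefl _⟩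
    have : ((τ.trans τ').map (collapseMap A).continuous).cast hx hx' =
        ((τ.map (collapseMap A).continuous).cast hx hx₁).trans
          ((τ'.map (collapseMap A).continuous).cast hx₁ hx') := by
      ext t
      simp [Path.trans_apply]
    rwa [this]

lemma joinedLiftIn_of_mem_closure (hA : ∀ i, IsOpen (A i))
    (hpc : ∀ i, IsPathConnected (closure (A i))) {O : Set (Quot (collapseRelFam A))}
    (hO : IsOpen O) {i : Fin n} {x₀ : X} (hx₀ : x₀ ∈ A i) {y : Quot (collapseRelFam A)}
    (hy : y ∈ closure {collapseMap A x₀}) (hyO : y ∈ O) :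
    Path.JoinedLiftIn (collapseMap A) O y (collapseMap A x₀) := by
  obtain ⟨x, rfl⟩ := collapseMap_surjective y
  have hsub : collapseMap A ⁻¹' {collapseMap A x₀} ⊆
      ⋃ j ∈ {j | ∃ z ∈ A j, collapseMap A z = collapseMap A x₀}, A j := by
    intro z hz
    rcases eq_or_mem_of_collapseMap_eq hz with rfl | ⟨⟨j, hj⟩, -⟩
    · exact mem_biUnion (show i ∈ {j | _} from ⟨z, hx₀, rfl⟩) hx₀
    · exact mem_biUnion (show j ∈ {j | _} from ⟨z, hj, hz⟩) hj
  have hx : x ∈ closure (collapseMap A ⁻¹' {collapseMap A x₀}) := by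
    rw [← (isOpenMap_collapseMap hA).preimage_closure_eq_closure_preimage
      (collapseMap A).continuous]
    exact hy
  replace hx := closure_mono hsub hx
  rw [(toFinite _).closure_biUnion] at hx
  obtain ⟨j, ⟨z, hzj, hz⟩, hxj⟩ := mem_iUnion₂.1 hx
  obtain ⟨τ, hτ⟩ := (hpc j).joinedIn x hxj z (subset_closure hzj)
  rw [← hz] at hy ⊢
  have hzO : collapseMap A z ∈ O := by
    obtain ⟨_, h, rfl⟩ := mem_closure_iff.1 hy O hO hyO
    exact h
  obtain ⟨ε, hε⟩ := Path.exists_eq_of_mem_closure_singleton hy (subset_closure rfl)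
  refine ⟨ε, fun t => ?_, (Path.LiftsUpToHomotopy.map
    (liftsUpToHomotopy_refl_collapseMap hpc) τ).of_homotopic
      (Path.homotopic_of_mem_closure_singleton (fun t => collapseMap_mem_closure hzj (hτ t))
        fun t => (hε t).2)⟩
  rcases (hε t).1 with h | h | h <;> rw [h] <;> assumption

/-- A path avoiding the images of the open sets `A i` lifts uniquely. -/
lemma liftsUpToHomotopy_of_forall_notMem (hA : ∀ i, IsOpen (A i)) {y y' : Quot (collapseRelFam A)}
    (ε : Path y y') (hε : ∀ t i, ε t ∉ collapseMap A '' A i) :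
    Path.LiftsUpToHomotopy (collapseMap A) ε := by
  rintro x x' rfl rfl
  let g : I → X := fun t => Function.surjInv collapseMap_surjective (ε t)
  have hg : ∀ t, collapseMap A (g t) = ε t := fun t => Function.surjInv_eq _ _
  have huniq : ∀ t z, collapseMap A z = ε t → z = g t := by
    intro t z hz
    rcases eq_or_mem_of_collapseMap_eq (hz.trans (hg t).symm) with h | ⟨⟨i, hi⟩, -⟩
    · exact h
    · exact absurd ⟨z, hi, hz⟩ (hε t i)
  have hgc : Continuous g := by
    refine continuous_def.2 fun V hV => ?_
    have : g ⁻¹' V = ε ⁻¹' (collapseMap A '' V) := by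
      ext t
      refine ⟨fun h => ⟨g t, h, hg t⟩, ?_⟩
      rintro ⟨z, hz, hzt⟩
      rw [mem_preimage, ← huniq t z hzt]
      exact hz
    rw [this]
    exact (isOpenMap_collapseMap hA V hV).preimage ε.continuous
  refine ⟨⟨⟨g, hgc⟩, (huniq 0 x (by simp)).symm, (huniq 1 x' (by simp)).symm⟩, ?_⟩
  convert Path.Homotopic.refl ε using 1
  ext t
  exact hg t

lemma joinedLiftIn_collapseMap_of_isOpen (hA : ∀ i, IsOpen (A i))
    (hpc : ∀ i, IsPathConnected (closure (A i))) (γ : C(I, Quot (collapseRelFam A)))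
    {O : Set (Quot (collapseRelFam A))} (hO : IsOpen O) (u v : I) (huv : u ≤ v)
    (hγ : MapsTo γ (Icc u v) O) :
    Path.JoinedLiftIn (collapseMap A) O (γ u) (γ v) := by
  have hne : ∀ i, ∃ x, x ∈ A i := fun i => closure_nonempty_iff.1 (hpc i).nonempty
  choose x hx using hne
  suffices H : ∀ (S : Finset (Fin n)) (u v : I), u ≤ v → MapsTo γ (Icc u v) O →
      (∀ i ∉ S, ∀ t ∈ Ioo u v, γ t ∉ closure {collapseMap A (x i)}) →
      Path.JoinedLiftIn (collapseMap A) O (γ u) (γ v) from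
    H Finset.univ u v huv hγ fun i hi => absurd (Finset.mem_univ i) hi
  clear huv hγ u v
  intro S
  induction S using Finset.induction_on with
  | empty =>
    intro u v huv hγ hS
    rcases huv.eq_or_lt with rfl | huv
    · exact ⟨Path.refl _, fun _ => hγ ⟨le_rfl, le_rfl⟩,
        liftsUpToHomotopy_refl_collapseMap hpc _⟩
    have hmem : ∀ s, Icc.convexComb u v s ∈ Icc u v := by
      intro s
      have := mem_range_self (f := Icc.convexComb u v) s
      rwa [Path.range_subpathAux, uIcc_of_le huv.le] at this
    refine ⟨(Path.ofMap γ).subpath u v, fun s => hγ (hmem s),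
      liftsUpToHomotopy_of_forall_notMem hA _ ?_⟩
    rintro s i ⟨z, hz, hzs⟩
    have hopen : IsOpen (γ ⁻¹' {collapseMap A (x i)}) :=
      (isOpen_singleton_collapseMap hA (hx i)).preimage γ.continuous
    have hs : Icc.convexComb u v s ∈ closure (Ioo u v) := by
      rw [closure_Ioo huv.ne]
      exact hmem s
    obtain ⟨t, ht, htuv⟩ := mem_closure_iff.1 hs _ hopen
      (hzs.symm.trans (collapseMap_eq_of_mem hz (hx i)))
    exact hS i (Finset.notMem_empty i) t htuv (subset_closure ht)
  | insert i S _ ih =>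
    intro u v huv hγ hS
    have hcl : IsClosed (γ ⁻¹' closure {collapseMap A (x i)}) :=
      isClosed_closure.preimage γ.continuous
    have hcpt : IsCompact (Icc u v ∩ γ ⁻¹' closure {collapseMap A (x i)}) :=
      (isClosed_Icc.inter hcl).isCompact
    rcases (Icc u v ∩ γ ⁻¹' closure {collapseMap A (x i)}).eq_empty_or_nonempty with he | hne
    · refine ih u v huv hγ fun j hj t ht hjt => ?_
      rcases eq_or_ne j i with rfl | hji
      · exact he.subset ⟨Ioo_subset_Icc_self ht, hjt⟩
      · exact hS j (by simp [hji, hj]) t ht hjt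
    · obtain ⟨s, ⟨hs, hsi⟩, hsmin⟩ := hcpt.exists_isLeast hne
      obtain ⟨s', ⟨hs', hsi'⟩, hsmax⟩ := hcpt.exists_isGreatest hne
      have h₁ := ih u s hs.1 (hγ.mono_left (Icc_subset_Icc_right hs.2)) fun j hj t ht hjt => by
        rcases eq_or_ne j i with rfl | hji
        · exact ht.2.not_ge (hsmin ⟨⟨ht.1.le, ht.2.le.trans hs.2⟩, hjt⟩)
        · exact hS j (by simp [hji, hj]) t ⟨ht.1, ht.2.trans_le hs.2⟩ hjt
      have h₂ := ih s' v hs'.2 (hγ.mono_left (Icc_subset_Icc_left hs'.1)) fun j hj t ht hjt => by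
        rcases eq_or_ne j i with rfl | hji
        · exact ht.1.not_ge (hsmax ⟨⟨hs'.1.trans ht.1.le, ht.2.le⟩, hjt⟩)
        · exact hS j (by simp [hji, hj]) t ⟨hs'.1.trans_lt ht.1, ht.2⟩ hjt
      have h₃ := joinedLiftIn_of_mem_closure hA hpc hO (hx i) hsi (hγ hs)
      have h₄ := joinedLiftIn_of_mem_closure hA hpc hO (hx i) hsi' (hγ hs')
      have hsurj := collapseMap_surjective (A := A)
      exact ((h₁.trans hsurj h₃).trans hsurj h₄.symm).trans hsurj h₂

lemma joinedLiftIn_collapseMap_of_locallyPathConnectedSpace [LocallyPathConnectedSpace X]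
    (hpc : ∀ i, IsPathConnected (closure (A i))) (γ : C(I, Quot (collapseRelFam A)))
    {O : Set (Quot (collapseRelFam A))} (hO : IsOpen O) (u v : I) (huv : u ≤ v)
    (hγ : MapsTo γ (Icc u v) O) :
    Path.JoinedLiftIn (collapseMap A) O (γ u) (γ v) := by
  have hsurj := collapseMap_surjective (A := A)
  have hF := liftsUpToHomotopy_refl_collapseMap hpc
  have hopen : ∀ y, IsOpen {y' | Path.JoinedLiftIn (collapseMap A) O y y'} := by
    intro y
    rw [← isOpen_preimage_collapseMap, isOpen_iff_mem_nhds]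
    rintro z hz
    have hzO : z ∈ collapseMap A ⁻¹' O := by
      obtain ⟨ε, hε, -⟩ := hz
      simpa using hε 1
    refine mem_of_superset
      (((hO.preimage (collapseMap A).continuous).pathComponentIn z).mem_nhds
        (mem_pathComponentIn_self hzO)) ?_
    rintro w ⟨τ, hτ⟩
    exact hz.trans hsurj ⟨τ.map (collapseMap A).continuous, hτ, .map hF τ⟩
  refine isPreconnected_Icc.induction₂
    (fun s t => Path.JoinedLiftIn (collapseMap A) O (γ s) (γ t)) (fun s hs => ?_)
    (fun r s t _ _ _ h h' => h.trans hsurj h') (fun s t _ _ h => h.symm)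
    (left_mem_Icc.2 huv) (right_mem_Icc.2 huv)
  exact mem_nhdsWithin_of_mem_nhds (((hopen (γ s)).preimage γ.continuous).mem_nhds
    ⟨Path.refl _, fun _ => hγ hs, hF _⟩)

/-- Under condition (*), the fundamental group of `X` has dense image in the topological
fundamental group of the quotient. -/
theorem denseRange_map_collapseMap (hstar : StarCondition A) (a : X) :
    DenseRange fun P : Path.Homotopic.Quotient a a => P.map (collapseMap A) := by
  have hpc : ∀ i, IsPathConnected (closure (A i)) := by
    rcases hstar with h | h
    exacts [fun i => (h.2 i).2, h.2.2.2.2.1]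
  have hL : ∀ (γ : C(I, Quot (collapseRelFam A))) (O : Set (Quot (collapseRelFam A))), IsOpen O →
      ∀ u v : I, u ≤ v → MapsTo γ (Icc u v) O →
        Path.JoinedLiftIn (collapseMap A) O (γ u) (γ v) := by
    intro γ O hO u v huv hγ
    rcases hstar with ⟨-, hA⟩ | ⟨-, -, hloc, -⟩
    · exact joinedLiftIn_collapseMap_of_isOpen (fun i => (hA i).1) hpc γ hO u v huv hγ
    · have : LocallyPathConnectedSpace X := hloc
      exact joinedLiftIn_collapseMap_of_locallyPathConnectedSpace hpc γ hO u v huv hγ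
  refine dense_iff_inter_open.2 fun U hU ⟨P, hP⟩ => ?_
  obtain ⟨γ, rfl⟩ := Path.Homotopic.Quotient.mk_surjective P
  have hW : Path.Homotopic.Quotient.mk ⁻¹' U ∈ 𝓝 γ :=
    (hU.preimage continuous_quotient_mk').mem_nhds hP
  obtain ⟨γ', hγ'U, hγ'⟩ := Path.exists_mem_liftsUpToHomotopy collapseMap_surjective
    (liftsUpToHomotopy_refl_collapseMap hpc) hL γ hW
  obtain ⟨τ, hτ⟩ := hγ' a a rfl rfl
  refine ⟨_, ?_, Path.Homotopic.Quotient.mk τ, rfl⟩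
  have : (Path.Homotopic.Quotient.mk τ).map (collapseMap A) = Path.Homotopic.Quotient.mk γ' :=
    Path.Homotopic.Quotient.eq.2 hτ
  change (Path.Homotopic.Quotient.mk τ).map (collapseMap A) ∈ U
  rw [this]
  exact hγ'U

end Collapse

/-- A path connected space whose topological fundamental group is discrete is semi-locally simply
connected. -/
theorem SemiLocallySimplyConnected.of_discreteTopology {Y : Type*} [TopologicalSpace Y]
    [PathConnectedSpace Y] (y₀ : Y) [DiscreteTopology (Path.Homotopic.Quotient y₀ y₀)] :
    SemiLocallySimplyConnected Y := by
  intro y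
  obtain ⟨α⟩ := PathConnectedSpace.joined y₀ y
  let Φ : Path y y → Path.Homotopic.Quotient y₀ y₀ := fun β =>
    Path.Homotopic.Quotient.mk ((α.trans β).trans α.symm)
  have hΦ : Continuous Φ := by
    refine continuous_quotient_mk'.comp ?_
    exact (continuous_const.path_trans continuous_id).path_trans continuous_const
  have hconj : ∀ P : Path.Homotopic.Quotient y y, P = (Path.Homotopic.Quotient.mk α.symm).trans
      ((((Path.Homotopic.Quotient.mk α).trans P).trans (Path.Homotopic.Quotient.mk α.symm)).trans
        (Path.Homotopic.Quotient.mk α)) := by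
    intro P
    simp only [Path.Homotopic.Quotient.mk_symm, Path.Homotopic.Quotient.trans_assoc,
      Path.Homotopic.Quotient.symm_trans, Path.Homotopic.Quotient.trans_refl]
    simp [← Path.Homotopic.Quotient.trans_assoc]
  have hinj : ∀ β : Path y y, Φ β = Φ (Path.refl y) → β.Homotopic (Path.refl y) := by
    intro β h
    simp only [Φ, Path.Homotopic.Quotient.mk_trans] at h
    refine Path.Homotopic.Quotient.exact ?_
    rw [hconj (Path.Homotopic.Quotient.mk β), h, ← hconj]
  have hmem : Φ ⁻¹' {Φ (Path.refl y)} ∈ 𝓝 (Path.refl y) :=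
    ((isOpen_discrete _).preimage hΦ).mem_nhds rfl
  obtain ⟨G, hG, hyG, hGΦ⟩ := Path.exists_isOpen_graph_subset _ hmem
  obtain ⟨V, U, -, hU, hV, hyU, hVU⟩ := generalized_tube_lemma (isCompact_univ (X := I))
    (isCompact_singleton (x := y)) hG (by rintro ⟨t, _⟩ ⟨-, rfl⟩; exact hyG t)
  exact ⟨U, hU, hyU rfl, fun γ => hinj _ <|
    hGΦ (γ.map continuous_subtype_val) fun t => hVU ⟨hV (mem_univ t), (γ t).2⟩⟩

/-- If `(X, A₁, …, Aₙ)` satisfies condition (*), `π₁(X,a)` is finite and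
`π₁ᵗᵒᵖ(X/(A₁,…,Aₙ),*)` is Hausdorff, then `π₁(X/(A₁,…,Aₙ),*)` is finite and
`X/(A₁,…,Aₙ)` is semi-locally simply connected. -/
theorem finite_pi1_quotient_and_slsc_of_finite_of_t2
    {X : Type*} [TopologicalSpace X]
    {n : ℕ} (A : Fin n → Set X) (hstar : StarCondition A)
    (a : X) (ha : a ∈ ⋃ i, A i)
    (hfin : Finite (Path.Homotopic.Quotient a a))
    (ht2 : T2Space (Path.Homotopic.Quotient (Quot.mk (collapseRelFam A) a)
      (Quot.mk (collapseRelFam A) a))) :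
    Finite (Path.Homotopic.Quotient (Quot.mk (collapseRelFam A) a)
        (Quot.mk (collapseRelFam A) a)) ∧
      SemiLocallySimplyConnected (Quot (collapseRelFam A)) := by
  have : T1Space (Path.Homotopic.Quotient (collapseMap A a) (collapseMap A a)) :=
    ht2.t1Space
  have hdense := denseRange_map_collapseMap hstar a
  have hrange : (range fun P : Path.Homotopic.Quotient a a => P.map (collapseMap A)) = univ := by
    rw [← hdense.closure_range]
    exact (finite_range _).isClosed.closure_eq.symm
  have hfinite : Finite (Path.Homotopic.Quotient (Quot.mk (collapseRelFam A) a)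
      (Quot.mk (collapseRelFam A) a)) :=
    finite_univ_iff.1 (hrange ▸ finite_range _)
  have hX : PathConnectedSpace X := by
    rcases hstar with h | ⟨-, hconn, hloc, -⟩
    · exact h.1
    · have : LocallyPathConnectedSpace X := hloc
      exact pathConnectedSpace_iff_connectedSpace.2 hconn
  have hY : PathConnectedSpace (Quot (collapseRelFam A)) :=
    collapseMap_surjective.pathConnectedSpace (collapseMap A).continuous
  exact ⟨hfinite, .of_discreteTopology (Quot.mk (collapseRelFam A) a)⟩
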